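/- For all odd positive integers w₁ and w₂, every complex number s, and every real number x > 0, one has ([w₂]_q^s/[2]_{q^{w₁}}^r) · Σ_{j₁,...,j_r = 0}^{w₁d − 1} (−1)^{j₁+⋯+j_r} (Π_{l=1}^{r} χ(j_l)) q^{w₂·Σ_{l=1}^{r}(h−l+1)j_l} · l_{q^{w₁},r}^{(h)}(s, w₂x + (w₂/w₁)(j₁+⋯+j_r) | χ) = [w₁]_q^s [w₂]_q^s · Σ_{i₁,...,i_r = 0}^{w₂d − 1} Σ_{j₁,...,j_r = 0}^{w₁d − 1} Σ_{n₁,...,n_r = 0}^{∞} (−1)^{Σ_{l=1}^{r}(i_l + j_l + n_l)} (Π_{l=1}^{r} χ(j_l)) (Π_{l=1}^{r} χ(i_l)) q^{w₂·Σ_{l=1}^{r}(h−l+1)j_l + w₁·Σ_{l=1}^{r}(h−l+1)i_l + w₁w₂d·Σ_{l=1}^{r}(h−l+1)n_l} / [w₁w₂(x + d(n₁+⋯+n_r)) + w₂(j₁+⋯+j_r) + w₁(i₁+⋯+i_r)]_q^s; in particular the right-hand side is symmetric under interchanging w₁ and w₂. -/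

import Mathlib

open Finset

/-- The `q`-number `[x]_q = (1 - q^x)/(1 - q)`, with real exponent. -/
noncomputable def qnum (q x : ℝ) : ℝ := (1 - q ^ x) / (1 - q)

/-- For a positive real `y`, the complex power `y^s = exp(s · log y)`,
using the real logarithm. -/
noncomputable def rcpow (y : ℝ) (s : ℂ) : ℂ := Complex.exp (s * (Real.log y : ℂ))

/-- The Dirichlet-type multiple `(h,q)`-`l`-function
`l_{q,r}^{(h)}(s, x|χ) = [2]_q^r · Σ_{m₁,…,m_r ≥ 0} q^{Σ_l (h-l+1) m_l} (-1)^{m₁+⋯+m_r}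
  (Π_l χ(m_l)) / [m₁+⋯+m_r+x]_q^s`,
with the index `l` running over `Fin r` (0-based, so `h - l + 1` becomes `h - l`). -/
noncomputable def multipleqL {d : ℕ} (χ : DirichletCharacter ℂ d) (q : ℝ) (h : ℤ) (r : ℕ)
    (s : ℂ) (x : ℝ) : ℂ :=
  ((qnum q 2 : ℝ) : ℂ) ^ r *
    ∑' m : Fin r → ℕ,
      ((q ^ (∑ l : Fin r, (h - (l.val : ℤ)) * (m l : ℤ)) : ℝ) : ℂ) *
        (-1 : ℂ) ^ (∑ l : Fin r, m l) * (∏ l : Fin r, χ ((m l : ℕ) : ZMod d)) /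
        rcpow (qnum q ((∑ l : Fin r, (m l : ℝ)) + x)) s

/-- The right-hand side of equation (2.2): `[w₁]_q^s [w₂]_q^s` times the triple sum
`Σ_{i₁,…,i_r=0}^{w₂d-1} Σ_{j₁,…,j_r=0}^{w₁d-1} Σ_{n₁,…,n_r ≥ 0}
  (-1)^{Σ(i_l+j_l+n_l)} (Π χ(j_l)) (Π χ(i_l))
  q^{w₂Σ(h-l+1)j_l + w₁Σ(h-l+1)i_l + w₁w₂dΣ(h-l+1)n_l}
  / [w₁w₂(x + dΣ n_l) + w₂Σ j_l + w₁Σ i_l]_q^s`. -/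
noncomputable def symTripleSum {d : ℕ} (χ : DirichletCharacter ℂ d) (q : ℝ) (h : ℤ)
    (r : ℕ) (s : ℂ) (x : ℝ) (w₁ w₂ : ℕ) : ℂ :=
  rcpow (qnum q w₁) s * rcpow (qnum q w₂) s *
    ∑ i : Fin r → Fin (w₂ * d), ∑ j : Fin r → Fin (w₁ * d), ∑' m : Fin r → ℕ,
      (-1 : ℂ) ^ (∑ l : Fin r, ((i l : ℕ) + (j l : ℕ) + m l)) *
        (∏ l : Fin r, χ ((j l : ℕ) : ZMod d)) * (∏ l : Fin r, χ ((i l : ℕ) : ZMod d)) *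
        ((q ^ ((w₂ : ℤ) * (∑ l : Fin r, (h - (l.val : ℤ)) * ((j l : ℕ) : ℤ)) +
              (w₁ : ℤ) * (∑ l : Fin r, (h - (l.val : ℤ)) * ((i l : ℕ) : ℤ)) +
              (w₁ : ℤ) * (w₂ : ℤ) * (d : ℤ) * ∑ l : Fin r, (h - (l.val : ℤ)) * (m l : ℤ))
          : ℝ) : ℂ) /
        rcpow (qnum q ((w₁ : ℝ) * (w₂ : ℝ) * (x + (d : ℝ) * ∑ l : Fin r, (m l : ℝ)) +
          (w₂ : ℝ) * ∑ l : Fin r, ((j l : ℕ) : ℝ) +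
          (w₁ : ℝ) * ∑ l : Fin r, ((i l : ℕ) : ℝ))) s

theorem qnum_pos {q y : ℝ} (hq0 : 0 < q) (hq1 : q < 1) (hy : 0 < y) : 0 < qnum q y :=
  div_pos (sub_pos.2 (Real.rpow_lt_one hq0.le hq1 hy)) (sub_pos.2 hq1)

theorem qnum_le_qnum {q y z : ℝ} (hq0 : 0 < q) (hq1 : q < 1) (hyz : y ≤ z) :
    qnum q y ≤ qnum q z := by
  have := sub_pos.2 hq1
  have := Real.rpow_le_rpow_of_exponent_ge hq0 hq1.le hyz
  unfold qnum
  gcongr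

theorem qnum_le_inv {q : ℝ} (hq0 : 0 < q) (hq1 : q < 1) (y : ℝ) : qnum q y ≤ 1 / (1 - q) := by
  have := sub_pos.2 hq1
  have := Real.rpow_pos_of_pos hq0 y
  unfold qnum
  gcongr
  linarith

/-- `[y]_{q^w} = [w y]_q / [w]_q`. -/
theorem qnum_pow_left {q : ℝ} (hq0 : 0 < q) (hq1 : q < 1) {w : ℕ} (hw : 0 < w) (y : ℝ) :
    qnum (q ^ w) y = qnum q (w * y) / qnum q w := by
  have h1 : 1 - q ≠ 0 := (sub_pos.2 hq1).ne'
  have h2 : 1 - q ^ w ≠ 0 := (sub_pos.2 (pow_lt_one₀ hq0.le hq1 hw.ne')).ne'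
  have h3 : (q ^ w) ^ y = q ^ ((w : ℝ) * y) := by
    rw [Real.rpow_mul hq0.le, Real.rpow_natCast]
  unfold qnum
  rw [h3, Real.rpow_natCast]
  field_simp

theorem rcpow_ne_zero (y : ℝ) (s : ℂ) : rcpow y s ≠ 0 := Complex.exp_ne_zero _

theorem rcpow_div {a b : ℝ} (ha : 0 < a) (hb : 0 < b) (s : ℂ) :
    rcpow (a / b) s = rcpow a s / rcpow b s := by
  unfold rcpow
  rw [Real.log_div ha.ne' hb.ne', ← Complex.exp_sub, Complex.ofReal_sub, mul_sub]

theorem norm_inv_rcpow_le {a b y : ℝ} (ha : 0 < a) (hay : a ≤ y) (hyb : y ≤ b) (s : ℂ) :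
    ‖(rcpow y s)⁻¹‖ ≤ Real.exp (|s.re| * max |Real.log a| |Real.log b|) := by
  have hy : 0 < y := ha.trans_le hay
  have hlog : |Real.log y| ≤ max |Real.log a| |Real.log b| :=
    abs_le_max_abs_abs (Real.log_le_log ha hay) (Real.log_le_log hy hyb)
  rw [rcpow, ← Complex.exp_neg, Complex.norm_exp, Real.exp_le_exp]
  calc (-(s * (Real.log y : ℂ))).re = -(s.re * Real.log y) := by simp
    _ ≤ |s.re * Real.log y| := neg_le_abs _
    _ = |s.re| * |Real.log y| := abs_mul _ _
    _ ≤ _ := by gcongr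

theorem summable_prod_pi_of_nonneg {β : Type*} {f : β → ℝ} (hf : Summable f) (hf0 : ∀ b, 0 ≤ f b)
    (r : ℕ) : Summable fun m : Fin r → β => ∏ l, f (m l) := by
  induction r with
  | zero => exact (hasSum_fintype _).summable
  | succ r ih =>
    rw [← (Fin.consEquiv fun _ : Fin (r + 1) => β).summable_iff]
    have := hf.mul_of_nonneg ih hf0 fun m => prod_nonneg fun l _ => hf0 (m l)
    refine this.congr fun p => ?_
    simp [Fin.consEquiv, Fin.prod_univ_succ]

/-- Splitting a multiple series along residue classes modulo `N`. -/
theorem tsum_pi_nat_eq_sum_residues {r N : ℕ} (hN : 0 < N) {f : (Fin r → ℕ) → ℂ}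
    (hf : Summable f) :
    ∑' m, f m = ∑ i : Fin r → Fin N, ∑' m : Fin r → ℕ, f fun l => i l + N * m l := by
  have : NeZero N := ⟨hN.ne'⟩
  let e : (Fin r → Fin N) × (Fin r → ℕ) ≃ (Fin r → ℕ) :=
    (Equiv.prodComm _ _).trans (((Equiv.arrowCongr (Equiv.refl (Fin r))
      (Nat.divModEquiv N)).trans (Equiv.arrowProdEquivProdArrow _ _ _)).symm)
  have he (p) : e p = fun l => (p.1 l : ℕ) + N * p.2 l := by
    funext l
    simp [e, Equiv.arrowProdEquivProdArrow, Nat.divModEquiv, add_comm, mul_comm]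
  rw [← e.tsum_eq f, Summable.tsum_prod (f := fun p => f (e p)) (e.summable_iff.2 hf),
    tsum_fintype]
  simp [he]

theorem summable_multipleqL {d : ℕ} (χ : DirichletCharacter ℂ d) {q : ℝ} (hq0 : 0 < q)
    (hq1 : q < 1) {h : ℤ} {r : ℕ} (hhr : (r : ℤ) ≤ h) (s : ℂ) {x : ℝ} (hx : 0 < x) :
    Summable fun m : Fin r → ℕ =>
      ((q ^ (∑ l : Fin r, (h - (l.val : ℤ)) * (m l : ℤ)) : ℝ) : ℂ) *
        (-1 : ℂ) ^ (∑ l : Fin r, m l) * (∏ l : Fin r, χ ((m l : ℕ) : ZMod d)) /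
        rcpow (qnum q ((∑ l : Fin r, (m l : ℝ)) + x)) s := by
  have hgeom := summable_prod_pi_of_nonneg (summable_geometric_of_lt_one hq0.le hq1)
    (fun n => pow_nonneg hq0.le n) r
  refine .of_norm_bounded (hgeom.mul_right
    (Real.exp (|s.re| * max |Real.log (qnum q x)| |Real.log (1 / (1 - q))|))) fun m => ?_
  have hexp : ∑ l : Fin r, (m l : ℤ) ≤ ∑ l : Fin r, (h - (l.val : ℤ)) * (m l : ℤ) := by
    refine sum_le_sum fun l _ => le_mul_of_one_le_left (by positivity) ?_
    have := l.isLt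
    omega
  have hpow : q ^ (∑ l : Fin r, (h - (l.val : ℤ)) * (m l : ℤ)) ≤ ∏ l, q ^ m l := by
    refine (zpow_le_zpow_right_of_le_one₀ hq0 hq1.le hexp).trans_eq ?_
    rw [prod_pow_eq_pow_sum, ← Nat.cast_sum, zpow_natCast]
  have hχ : ‖∏ l : Fin r, χ ((m l : ℕ) : ZMod d)‖ ≤ 1 := by
    rw [norm_prod]
    exact prod_le_one (fun _ _ => norm_nonneg _) fun _ _ => χ.norm_le_one _
  have hinv := norm_inv_rcpow_le (s := s) (qnum_pos hq0 hq1 hx)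
    (qnum_le_qnum hq0 hq1 (le_add_of_nonneg_left (by positivity : 0 ≤ ∑ l, (m l : ℝ))))
    (qnum_le_inv hq0 hq1 _)
  rw [div_eq_mul_inv, norm_mul, norm_mul, norm_mul, norm_pow, norm_neg, norm_one, one_pow, mul_one,
    Complex.norm_real, Real.norm_of_nonneg (zpow_nonneg hq0.le _)]
  refine mul_le_mul ?_ hinv (norm_nonneg _) (by positivity)
  exact (mul_le_of_le_one_right (by positivity) hχ).trans hpow

theorem symTripleSum_comm {d : ℕ} (χ : DirichletCharacter ℂ d) (q : ℝ) (h : ℤ) (r : ℕ) (s : ℂ)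
    (x : ℝ) (w₁ w₂ : ℕ) :
    symTripleSum χ q h r s x w₁ w₂ = symTripleSum χ q h r s x w₂ w₁ := by
  unfold symTripleSum
  rw [sum_comm, mul_comm (rcpow (qnum q w₁) s)]
  congr 1
  refine sum_congr rfl fun j _ => sum_congr rfl fun i _ => tsum_congr fun m => ?_
  congr 1
  · rw [mul_right_comm ((-1 : ℂ) ^ _)]
    congr 3
    · congr 1
      exact sum_congr rfl fun l _ => by ring
    · rw [mul_comm (w₁ : ℤ) w₂]
      ring
  · congr 2
    ring

/-- The series defining `l_{q^w,r}^{(h)}`, split along residue classes modulo `v d`. -/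
theorem multipleqL_pow_eq_sum_residues {d : ℕ} (hd0 : 0 < d) (hdodd : Odd d)
    (χ : DirichletCharacter ℂ d) {q : ℝ} (hq0 : 0 < q) (hq1 : q < 1) {r : ℕ} {h : ℤ}
    (hhr : (r : ℤ) ≤ h) {w v : ℕ} (hw : 0 < w) (hv : 0 < v) (hvodd : Odd v) (s : ℂ) {y : ℝ}
    (hy : 0 < y) :
    multipleqL χ (q ^ w) h r s y = ((qnum (q ^ w) 2 : ℝ) : ℂ) ^ r *
      (rcpow (qnum q w) s * ∑ i : Fin r → Fin (v * d), ∑' m : Fin r → ℕ,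
        (-1 : ℂ) ^ (∑ l : Fin r, ((i l : ℕ) + m l)) * (∏ l : Fin r, χ ((i l : ℕ) : ZMod d)) *
        ((q ^ ((w : ℤ) * (∑ l : Fin r, (h - (l.val : ℤ)) * ((i l : ℕ) : ℤ)) +
              (w : ℤ) * (v : ℤ) * (d : ℤ) * ∑ l : Fin r, (h - (l.val : ℤ)) * (m l : ℤ))
          : ℝ) : ℂ) /
        rcpow (qnum q ((w : ℝ) * (v : ℝ) * (d : ℝ) * ∑ l : Fin r, (m l : ℝ) +
          (w : ℝ) * ∑ l : Fin r, ((i l : ℕ) : ℝ) + w * y)) s) := by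
  have hQ0 : 0 < q ^ w := pow_pos hq0 w
  have hQ1 : q ^ w < 1 := pow_lt_one₀ hq0.le hq1 hw.ne'
  have hw' : (0 : ℝ) < w := by exact_mod_cast hw
  unfold multipleqL
  rw [tsum_pi_nat_eq_sum_residues (Nat.mul_pos hv hd0) (summable_multipleqL χ hQ0 hQ1 hhr s hy)]
  congr 1
  refine Eq.trans (sum_congr rfl fun i _ => ?_) (mul_sum _ _ _).symm
  rw [← tsum_mul_left]
  refine tsum_congr fun m => ?_
  have hpow : (q ^ w) ^ (∑ l : Fin r, (h - (l.val : ℤ)) * (((i l : ℕ) + v * d * m l : ℕ) : ℤ)) =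
      q ^ ((w : ℤ) * (∑ l : Fin r, (h - (l.val : ℤ)) * ((i l : ℕ) : ℤ)) +
        (w : ℤ) * (v : ℤ) * (d : ℤ) * ∑ l : Fin r, (h - (l.val : ℤ)) * (m l : ℤ)) := by
    rw [← zpow_natCast q w, ← zpow_mul]
    congr 1
    simp only [mul_sum, ← sum_add_distrib]
    refine sum_congr rfl fun l _ => ?_
    push_cast
    ring
  have hsign : (-1 : ℂ) ^ (∑ l : Fin r, ((i l : ℕ) + v * d * m l)) =
      (-1 : ℂ) ^ (∑ l : Fin r, ((i l : ℕ) + m l)) := by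
    simp only [← prod_pow_eq_pow_sum, pow_add, pow_mul, (hvodd.mul hdodd).neg_one_pow]
  have hχ : ∏ l : Fin r, χ (((i l : ℕ) + v * d * m l : ℕ) : ZMod d) =
      ∏ l : Fin r, χ ((i l : ℕ) : ZMod d) := by
    simp
  have harg : (w : ℝ) * ((∑ l : Fin r, (((i l : ℕ) + v * d * m l : ℕ) : ℝ)) + y) =
      (w : ℝ) * (v : ℝ) * (d : ℝ) * ∑ l : Fin r, (m l : ℝ) +
          (w : ℝ) * ∑ l : Fin r, ((i l : ℕ) : ℝ) + w * y := by
    push_cast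
    rw [sum_add_distrib, ← mul_sum]
    ring
  have hden : 0 < (w : ℝ) * ((∑ l : Fin r, (((i l : ℕ) + v * d * m l : ℕ) : ℝ)) + y) := by
    positivity
  rw [hpow, hsign, hχ, qnum_pow_left hq0 hq1 hw,
    rcpow_div (qnum_pos hq0 hq1 hden) (qnum_pos hq0 hq1 hw'), harg]
  have := rcpow_ne_zero (qnum q w) s
  field_simp

/-- Equation (2.2): for odd `w₁, w₂`, `s ∈ ℂ` and `x > 0`,
`([w₂]_q^s/[2]_{q^{w₁}}^r) Σ_{j₁,…,j_r=0}^{w₁d-1} (-1)^{Σ j_l} (Π χ(j_l))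
    q^{w₂Σ(h-l+1)j_l} l_{q^{w₁},r}^{(h)}(s, w₂x + (w₂/w₁)Σ j_l | χ)`
equals the triple sum `symTripleSum χ q h r s x w₁ w₂`; in particular, the latter is
symmetric under interchanging `w₁` and `w₂`. -/
theorem multipleqL_sum_eq_symTripleSum {d : ℕ} (hd0 : 0 < d) (hdodd : Odd d)
    (χ : DirichletCharacter ℂ d) (q : ℝ) (hq0 : 0 < q) (hq1 : q < 1)
    (r : ℕ) (hr : 1 ≤ r) (h : ℤ) (hhr : (r : ℤ) ≤ h)
    (w₁ w₂ : ℕ) (hw₁ : 0 < w₁) (hw₁odd : Odd w₁) (hw₂ : 0 < w₂) (hw₂odd : Odd w₂)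
    (s : ℂ) (x : ℝ) (hx : 0 < x) :
    (rcpow (qnum q w₂) s / ((qnum (q ^ w₁) 2 : ℝ) : ℂ) ^ r) *
        (∑ j : Fin r → Fin (w₁ * d),
          (-1 : ℂ) ^ (∑ l : Fin r, (j l : ℕ)) * (∏ l : Fin r, χ ((j l : ℕ) : ZMod d)) *
            ((q ^ ((w₂ : ℤ) * ∑ l : Fin r, (h - (l.val : ℤ)) * ((j l : ℕ) : ℤ)) : ℝ) : ℂ) *
            multipleqL χ (q ^ w₁) h r s
              ((w₂ : ℝ) * x + ((w₂ : ℝ) / (w₁ : ℝ)) * ∑ l : Fin r, ((j l : ℕ) : ℝ)))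
      = symTripleSum χ q h r s x w₁ w₂ ∧
    symTripleSum χ q h r s x w₁ w₂ = symTripleSum χ q h r s x w₂ w₁ := by
  refine ⟨?_, symTripleSum_comm χ q h r s x w₁ w₂⟩
  have hw₁' : (0 : ℝ) < w₁ := by exact_mod_cast hw₁
  have hw₂' : (0 : ℝ) < w₂ := by exact_mod_cast hw₂
  have htwo : ((qnum (q ^ w₁) 2 : ℝ) : ℂ) ^ r ≠ 0 := pow_ne_zero _ <| Complex.ofReal_ne_zero.2
    (qnum_pos (pow_pos hq0 w₁) (pow_lt_one₀ hq0.le hq1 hw₁.ne') two_pos).ne'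
  unfold symTripleSum
  rw [sum_comm, mul_sum, mul_sum]
  refine sum_congr rfl fun j _ => ?_
  rw [multipleqL_pow_eq_sum_residues hd0 hdodd χ hq0 hq1 hhr hw₁ hw₂ hw₂odd s (by positivity)]
  have hcancel (A S : ℂ) : rcpow (qnum q w₂) s / ((qnum (q ^ w₁) 2 : ℝ) : ℂ) ^ r *
      (A * (((qnum (q ^ w₁) 2 : ℝ) : ℂ) ^ r * (rcpow (qnum q w₁) s * S))) =
      rcpow (qnum q w₁) s * rcpow (qnum q w₂) s * (A * S) := by
    field_simp
  rw [hcancel]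
  congr 1
  refine (mul_sum _ _ _).trans (sum_congr rfl fun i _ => ?_)
  rw [← tsum_mul_left]
  refine tsum_congr fun m => ?_
  rw [← mul_div_assoc]
  congr 1
  · rw [add_assoc ((w₂ : ℤ) * _), zpow_add₀ hq0.ne' ((w₂ : ℤ) * _)]
    simp only [sum_add_distrib, pow_add, Complex.ofReal_mul]
    ring
  · congr 2
    field_simp
    ring
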